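/- arXiv:2409.07395 — 2 statements merged into one kernel-verified Lean document; each statement's English description precedes it below -/
import Mathlib

section
/- Let 1 < p < ∞ and let Q₀ ⊂ ℝⁿ be a cube. There is a constant C = C(n,p) such that for every f ∈ L¹(Q₀), ‖f − f_{Q₀}‖_{L^{p,∞}(Q₀)} ≤ C · ‖f‖_{GaRoₚ(Q₀,𝒟)}, i.e. the weak Lᵖ norm of f − f_{Q₀} on Q₀ is controlled by the dyadic Garsia–Rodemich norm of f. -/
open MeasureTheory Set
open scoped ENNReal Classical

noncomputable section

/-- The cube in `ℝⁿ` with lower-left corner `c` and sidelength `L`. -/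
def cube (n : ℕ) (c : Fin n → ℝ) (L : ℝ) : Set (Fin n → ℝ) :=
  Set.univ.pi fun i => Set.Ico (c i) (c i + L)

/-- The dyadic subcube of generation `k` and index `j` (sidelength `L / 2 ^ k`)
of the cube with corner `c` and sidelength `L`; it is a genuine subcube
when `∀ i, j i < 2 ^ k`. -/
def dsub (n : ℕ) (c : Fin n → ℝ) (L : ℝ) (k : ℕ) (j : Fin n → ℕ) : Set (Fin n → ℝ) :=
  Set.univ.pi fun i =>
    Set.Ico (c i + (j i : ℝ) * (L / 2 ^ k)) (c i + ((j i : ℝ) + 1) * (L / 2 ^ k))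

/-- The dyadic Garsia–Rodemich property: `C₀` is an admissible constant for `f` on the cube
`Q₀ = cube n c L`, i.e. for every pairwise disjoint collection `P` of dyadic subcubes of
`Q₀`, `∑_{Q∈P} (1/|Q|) ∫_Q ∫_Q |f x - f y| ≤ C₀ (∑_{Q∈P} |Q|)^{1/p'}`. -/
def GaRoConst (n : ℕ) (c : Fin n → ℝ) (L : ℝ) (p : ℝ) (f : (Fin n → ℝ) → ℝ) (C₀ : ℝ) : Prop :=
  ∀ P : Set (ℕ × (Fin n → ℕ)),
    (∀ Q ∈ P, ∀ i, Q.2 i < 2 ^ Q.1) →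
    (P.PairwiseDisjoint fun Q => dsub n c L Q.1 Q.2) →
    (∑' Q : ℕ × (Fin n → ℕ),
        if Q ∈ P then
          ENNReal.ofReal ((volume (dsub n c L Q.1 Q.2)).toReal⁻¹ *
            ∫ x in dsub n c L Q.1 Q.2, ∫ y in dsub n c L Q.1 Q.2, |f x - f y|)
        else 0)
      ≤ ENNReal.ofReal C₀ *
        (∑' Q : ℕ × (Fin n → ℕ), if Q ∈ P then volume (dsub n c L Q.1 Q.2) else 0)
          ^ (1 - 1 / p)

section DyadicCubes

variable {n : ℕ} {c : Fin n → ℝ} {L : ℝ}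

/-- The index of the generation `k` dyadic subcube containing `x`. -/
def dyadicIndex (c : Fin n → ℝ) (L : ℝ) (k : ℕ) (x : Fin n → ℝ) : Fin n → ℕ :=
  fun i => ⌊(x i - c i) / L * 2 ^ k⌋₊

lemma measurableSet_dsub (k : ℕ) (j : Fin n → ℕ) : MeasurableSet (dsub n c L k j) :=
  MeasurableSet.univ_pi fun _ => measurableSet_Ico

lemma dsub_zero : dsub n c L 0 (fun _ => 0) = cube n c L := by
  simp [dsub, cube]

lemma mem_dsub_iff (hL : 0 < L) {x : Fin n → ℝ} (hx : ∀ i, c i ≤ x i) (k : ℕ) (j : Fin n → ℕ) :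
    x ∈ dsub n c L k j ↔ dyadicIndex c L k x = j := by
  simp only [dsub, Set.mem_univ_pi, Set.mem_Ico, funext_iff, dyadicIndex]
  refine forall_congr' fun i => ?_
  have h0 : 0 ≤ (x i - c i) / L * 2 ^ k := by
    have := sub_nonneg.2 (hx i)
    positivity
  have hk : (0 : ℝ) < L / 2 ^ k := by positivity
  have hxi : x i = c i + (x i - c i) / L * 2 ^ k * (L / 2 ^ k) := by
    field_simp; ring
  rw [Nat.floor_eq_iff h0]
  generalize (x i - c i) / L * 2 ^ k = u at *
  rw [hxi, add_le_add_iff_left, add_lt_add_iff_left, mul_le_mul_iff_left₀ hk,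
    mul_lt_mul_iff_left₀ hk]

lemma le_of_mem_dsub (hL : 0 < L) {k : ℕ} {j : Fin n → ℕ} {x : Fin n → ℝ}
    (hx : x ∈ dsub n c L k j) (i : Fin n) : c i ≤ x i := by
  have h := (hx i (Set.mem_univ i)).1
  have : 0 ≤ (j i : ℝ) * (L / 2 ^ k) := by positivity
  linarith

lemma dyadicIndex_div (k d : ℕ) (x : Fin n → ℝ) (i : Fin n) :
    dyadicIndex c L (k + d) x i / 2 ^ d = dyadicIndex c L k x i := by
  unfold dyadicIndex
  rw [← Nat.floor_div_natCast]
  congr 1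
  push_cast
  rw [pow_add]
  field_simp

lemma dsub_subset_ancestor (hL : 0 < L) {k k' : ℕ} (hk : k' ≤ k) (j : Fin n → ℕ) :
    dsub n c L k j ⊆ dsub n c L k' (fun i => j i / 2 ^ (k - k')) := by
  intro x hx
  have h0 := le_of_mem_dsub hL hx
  rw [mem_dsub_iff hL h0] at hx ⊢
  subst hx
  obtain ⟨d, rfl⟩ := Nat.exists_eq_add_of_le hk
  ext i
  simp [dyadicIndex_div]

lemma dsub_subset_cube (hL : 0 < L) {k : ℕ} {j : Fin n → ℕ} (hj : ∀ i, j i < 2 ^ k) :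
    dsub n c L k j ⊆ cube n c L := by
  have h := dsub_subset_ancestor (c := c) hL (Nat.zero_le k) j
  have h0 : (fun i => j i / 2 ^ (k - 0)) = fun _ : Fin n => 0 := by
    ext i; simpa using hj i
  rwa [h0, dsub_zero] at h

lemma dyadicIndex_lt (hL : 0 < L) {x : Fin n → ℝ} (hx : x ∈ cube n c L) (k : ℕ) (i : Fin n) :
    dyadicIndex c L k x i < 2 ^ k := by
  have h0 : ∀ i, c i ≤ x i := fun i => (hx i (Set.mem_univ i)).1
  rw [← dsub_zero, mem_dsub_iff hL h0] at hx
  have h := dyadicIndex_div (c := c) (L := L) 0 k x i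
  rw [hx, zero_add] at h
  exact (Nat.div_eq_zero_iff_lt (by positivity)).1 h

lemma volume_dsub (k : ℕ) (j : Fin n → ℕ) :
    volume (dsub n c L k j) = ENNReal.ofReal (L / 2 ^ k) ^ n := by
  rw [dsub, Real.volume_pi_Ico]
  simp [add_mul]

lemma volume_dsub_ne_top (k : ℕ) (j : Fin n → ℕ) : volume (dsub n c L k j) ≠ ∞ := by
  rw [volume_dsub]; exact ENNReal.pow_ne_top ENNReal.ofReal_ne_top

lemma volume_dsub_ne_zero (hL : 0 < L) (k : ℕ) (j : Fin n → ℕ) :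
    volume (dsub n c L k j) ≠ 0 := by
  rw [volume_dsub]
  exact pow_ne_zero _ (ENNReal.ofReal_pos.2 (by positivity)).ne'

lemma volume_dsub_eq_mul_child (k : ℕ) (j j' : Fin n → ℕ) :
    volume (dsub n c L k j) = 2 ^ n * volume (dsub n c L (k + 1) j') := by
  rw [volume_dsub, volume_dsub, ← mul_pow]
  congr 1
  rw [← ENNReal.ofReal_ofNat 2, ← ENNReal.ofReal_mul (by norm_num)]
  congr 1
  rw [pow_succ]; field_simp

/-- Lebesgue differentiation along the dyadic subcubes of a cube. -/
lemma ae_tendsto_average_dsub (hL : 0 < L) {f : (Fin n → ℝ) → ℝ}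
    (hf : IntegrableOn f (cube n c L)) :
    ∀ᵐ x, x ∈ cube n c L → Filter.Tendsto
      (fun k => ⨍ y in dsub n c L k (dyadicIndex c L k x), f y) Filter.atTop (nhds (f x)) := by
  have hm : MeasurableSet (cube n c L) := MeasurableSet.univ_pi fun _ => measurableSet_Ico
  have hg : Integrable ((cube n c L).indicator f) := (integrable_indicator_iff hm).2 hf
  filter_upwards [IsUnifLocDoublingMeasure.ae_tendsto_average volume hg.locallyIntegrable 1]
    with x hx hxc
  have h0 : ∀ i, c i ≤ x i := fun i => (hxc i (Set.mem_univ i)).1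
  let w : ℕ → Fin n → ℝ :=
    fun k i => c i + ((dyadicIndex c L k x i : ℝ) + 1 / 2) * (L / 2 ^ k)
  let r : ℕ → ℝ := fun k => L / 2 ^ k / 2
  have hr : ∀ k, 0 < r k := fun k => by positivity
  have hball : ∀ k, Metric.closedBall (w k) (r k) = Set.univ.pi fun i =>
      Set.Icc (c i + (dyadicIndex c L k x i : ℝ) * (L / 2 ^ k))
        (c i + ((dyadicIndex c L k x i : ℝ) + 1) * (L / 2 ^ k)) := fun k => by
    rw [closedBall_pi _ (hr k).le]
    congr 1; ext1 i
    rw [Real.closedBall_eq_Icc]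
    congr 1 <;> simp only [w, r] <;> ring
  have hmem : ∀ k, x ∈ dsub n c L k (dyadicIndex c L k x) := fun k =>
    (mem_dsub_iff hL h0 k _).2 rfl
  have hlim : Filter.Tendsto r Filter.atTop (nhdsWithin 0 (Set.Ioi 0)) := by
    refine tendsto_nhdsWithin_iff.2 ⟨?_, Filter.Eventually.of_forall hr⟩
    have := (tendsto_pow_atTop_nhds_zero_of_lt_one (r := (1 / 2 : ℝ))
      (by norm_num) (by norm_num)).const_mul (L / 2)
    rw [mul_zero] at this
    refine this.congr fun k => ?_
    simp only [r, one_div, inv_pow]; ring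
  have key := hx w r hlim (Filter.Eventually.of_forall fun k => by
    rw [one_mul, hball]
    exact Set.pi_mono (fun i _ => Set.Ico_subset_Icc_self) (hmem k))
  rw [Set.indicator_of_mem hxc] at key
  refine key.congr fun k => ?_
  have hae : (Metric.closedBall (w k) (r k) : Set (Fin n → ℝ)) =ᵐ[volume]
      dsub n c L k (dyadicIndex c L k x) := by
    rw [hball]
    have := (Measure.univ_pi_Ico_ae_eq_Icc (μ := fun _ : Fin n => (volume : Measure ℝ))
      (f := fun i => c i + (dyadicIndex c L k x i : ℝ) * (L / 2 ^ k))
      (g := fun i => c i + ((dyadicIndex c L k x i : ℝ) + 1) * (L / 2 ^ k))).symm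
    rw [← Set.pi_univ_Icc] at this
    exact this
  rw [setAverage_congr hae]
  refine setAverage_congr_fun (measurableSet_dsub _ _) (Filter.Eventually.of_forall fun y hy => ?_)
  exact Set.indicator_of_mem (dsub_subset_cube hL (dyadicIndex_lt hL hxc k) hy) f

end DyadicCubes

section Oscillation

variable {α : Type*} [MeasurableSpace α] {μ : Measure α} {f : α → ℝ} {E : Set α}

/-- The mean distance to the average is at most the mean of the pairwise distances. -/
lemma lintegral_abs_sub_average_le [SFinite μ] (hE : μ E ≠ 0) (hE' : μ E ≠ ∞)
    (hf : IntegrableOn f E μ) :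
    ∫⁻ x in E, ENNReal.ofReal |f x - ⨍ y in E, f y ∂μ| ∂μ ≤
      ENNReal.ofReal ((μ E).toReal⁻¹ * ∫ x in E, ∫ y in E, |f x - f y| ∂μ ∂μ) := by
  have : IsFiniteMeasure (μ.restrict E) := ⟨by simpa using hE'.lt_top⟩
  have hpos : 0 < (μ E).toReal := ENNReal.toReal_pos hE hE'
  have hprod : Integrable (fun z : α × α => |f z.1 - f z.2|)
      ((μ.restrict E).prod (μ.restrict E)) :=
    ((hf.comp_fst (μ.restrict E)).sub (hf.comp_snd (μ.restrict E))).abs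
  have hpair := hprod.integral_prod_left
  have hdev : Integrable (fun x => |f x - ⨍ y in E, f y ∂μ|) (μ.restrict E) :=
    (hf.sub (integrable_const _)).abs
  rw [← integral_const_mul, ← ofReal_integral_eq_lintegral_ofReal hdev
    (Filter.Eventually.of_forall fun x => abs_nonneg _)]
  refine ENNReal.ofReal_le_ofReal (integral_mono hdev (hpair.const_mul _) fun x => ?_)
  have h1 : f x - ⨍ y in E, f y ∂μ = (μ E).toReal⁻¹ * ∫ y in E, (f x - f y) ∂μ := by
    rw [setAverage_eq, integral_sub (integrable_const _) hf]
    simp only [integral_const, smul_eq_mul, measureReal_def, Measure.restrict_apply_univ]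
    field_simp
  change |f x - ⨍ y in E, f y ∂μ| ≤ _
  rw [h1, abs_mul, abs_of_pos (inv_pos.2 hpos)]
  exact mul_le_mul_of_nonneg_left abs_integral_le_integral_abs (inv_pos.2 hpos).le

lemma ofReal_mul_measure_le_lintegral_of_lt_abs_average_sub (hE : μ E ≠ 0) (hE' : μ E ≠ ∞)
    (hf : IntegrableOn f E μ) {a l : ℝ} (h : l ≤ |(⨍ y in E, f y ∂μ) - a|) :
    ENNReal.ofReal l * μ E ≤ ∫⁻ x in E, ENNReal.ofReal |f x - a| ∂μ := by
  have : IsFiniteMeasure (μ.restrict E) := ⟨by simpa using hE'.lt_top⟩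
  have hpos : 0 < (μ E).toReal := ENNReal.toReal_pos hE hE'
  have hi : Integrable (fun x => f x - a) (μ.restrict E) := hf.sub (integrable_const _)
  rw [← ofReal_integral_eq_lintegral_ofReal hi.abs
    (Filter.Eventually.of_forall fun x => abs_nonneg _), ← ENNReal.ofReal_toReal hE',
    ← ENNReal.ofReal_mul' hpos.le]
  refine ENNReal.ofReal_le_ofReal ?_
  have h1 : ∫ x in E, (f x - a) ∂μ = ((⨍ y in E, f y ∂μ) - a) * (μ E).toReal := by
    rw [setAverage_eq, integral_sub hf (integrable_const _)]
    simp only [integral_const, smul_eq_mul, measureReal_def, Measure.restrict_apply_univ]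
    field_simp
  calc l * (μ E).toReal ≤ |(⨍ y in E, f y ∂μ) - a| * (μ E).toReal := by gcongr
    _ = |∫ x in E, (f x - a) ∂μ| := by rw [h1, abs_mul, abs_of_pos hpos]
    _ ≤ _ := abs_integral_le_integral_abs

end Oscillation

section Stopping

variable {n : ℕ} {c : Fin n → ℝ} {L : ℝ} {f : (Fin n → ℝ) → ℝ} {m l : ℝ}

/-- Some dyadic child of the subcube `(k, j)` has a mean at distance more than `l` from `m`. -/
def HasLargeChild (n : ℕ) (c : Fin n → ℝ) (L : ℝ) (f : (Fin n → ℝ) → ℝ) (m l : ℝ)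
    (k : ℕ) (j : Fin n → ℕ) : Prop :=
  ∃ j' : Fin n → ℕ, (∀ i, j' i / 2 = j i) ∧ l < |(⨍ y in dsub n c L (k + 1) j', f y) - m|

/-- The maximal dyadic subcubes having a child with mean at distance more than `l` from `m`. -/
def stopCubes (n : ℕ) (c : Fin n → ℝ) (L : ℝ) (f : (Fin n → ℝ) → ℝ) (m l : ℝ) :
    Set (ℕ × (Fin n → ℕ)) :=
  {Q | (∀ i, Q.2 i < 2 ^ Q.1) ∧ HasLargeChild n c L f m l Q.1 Q.2 ∧
    ∀ k < Q.1, ¬ HasLargeChild n c L f m l k (fun i => Q.2 i / 2 ^ (Q.1 - k))}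

/-- The union of the cubes in `stopCubes`. -/
def stopSet (n : ℕ) (c : Fin n → ℝ) (L : ℝ) (f : (Fin n → ℝ) → ℝ) (m l : ℝ) :
    Set (Fin n → ℝ) :=
  ⋃ Q ∈ stopCubes n c L f m l, dsub n c L Q.1 Q.2

lemma HasLargeChild.mono {l' : ℝ} (hl : l' ≤ l) {k : ℕ} {j : Fin n → ℕ}
    (h : HasLargeChild n c L f m l k j) : HasLargeChild n c L f m l' k j := by
  obtain ⟨j', h1, h2⟩ := h
  exact ⟨j', h1, hl.trans_lt h2⟩

lemma HasLargeChild.exists_stopCube (hL : 0 < L) {k : ℕ} {j : Fin n → ℕ}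
    (hj : ∀ i, j i < 2 ^ k) (h : HasLargeChild n c L f m l k j) :
    ∃ Q ∈ stopCubes n c L f m l, dsub n c L k j ⊆ dsub n c L Q.1 Q.2 := by
  have hex : ∃ k', k' ≤ k ∧ HasLargeChild n c L f m l k' (fun i => j i / 2 ^ (k - k')) :=
    ⟨k, le_rfl, by simpa using h⟩
  obtain ⟨hk, hbad⟩ := Nat.find_spec hex
  have hmin := fun {k'} => Nat.find_min (H := hex) (m := k')
  generalize Nat.find hex = k₀ at hk hbad hmin
  refine ⟨(k₀, fun i => j i / 2 ^ (k - k₀)), ⟨fun i => ?_, hbad, fun k' hk' hb => ?_⟩,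
    dsub_subset_ancestor hL hk j⟩
  · rw [Nat.div_lt_iff_lt_mul (by positivity), ← pow_add, Nat.add_sub_cancel' hk]
    exact hj i
  · refine hmin hk' ⟨(hk'.trans_le hk).le, ?_⟩
    simp only [Nat.div_div_eq_div_mul, ← pow_add] at hb
    change k' < k₀ at hk'
    rwa [show k - k₀ + (k₀ - k') = k - k' by omega] at hb

lemma pairwiseDisjoint_stopCubes (hL : 0 < L) :
    (stopCubes n c L f m l).PairwiseDisjoint fun Q => dsub n c L Q.1 Q.2 := by
  have key : ∀ Q ∈ stopCubes n c L f m l, ∀ R ∈ stopCubes n c L f m l, Q.1 ≤ R.1 →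
      ∀ x ∈ dsub n c L Q.1 Q.2, x ∈ dsub n c L R.1 R.2 → Q = R := by
    rintro ⟨k, j⟩ hQ ⟨k', j'⟩ hR hk x hx hx'
    dsimp only at hk hx hx'
    have h0 := le_of_mem_dsub hL hx
    rw [mem_dsub_iff hL h0] at hx hx'
    subst hx hx'
    obtain ⟨d, rfl⟩ := Nat.exists_eq_add_of_le hk
    rcases Nat.eq_zero_or_pos d with rfl | hd
    · rfl
    · refine absurd hQ.2.1 ?_
      have := hR.2.2 k (by dsimp only; omega)
      simpa [dyadicIndex_div] using this
  intro Q hQ R hR hne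
  refine Set.disjoint_left.2 fun x hx hx' => hne ?_
  rcases le_total Q.1 R.1 with h | h
  · exact key Q hQ R hR h x hx hx'
  · exact (key R hR Q hQ h x hx' hx).symm

lemma stopSet_subset_cube (hL : 0 < L) : stopSet n c L f m l ⊆ cube n c L :=
  Set.iUnion₂_subset fun _ hQ => dsub_subset_cube hL hQ.1

lemma volume_stopSet (hL : 0 < L) : volume (stopSet n c L f m l) =
    ∑' Q : stopCubes n c L f m l, volume (dsub n c L Q.1.1 Q.1.2) :=
  measure_biUnion (Set.to_countable _) (pairwiseDisjoint_stopCubes hL)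
    fun _ _ => measurableSet_dsub _ _

/-- A maximal cube is not itself the child of a cube with a large child, so its mean is close to
that of the whole cube. -/
lemma abs_average_sub_le_of_mem_stopCubes (hl : 0 ≤ l) {Q : ℕ × (Fin n → ℕ)}
    (hQ : Q ∈ stopCubes n c L f (⨍ y in cube n c L, f y) l) :
    |(⨍ y in dsub n c L Q.1 Q.2, f y) - ⨍ y in cube n c L, f y| ≤ l := by
  obtain ⟨k, j⟩ := Q
  obtain ⟨hj, -, hmin⟩ := hQ
  dsimp only at hj hmin ⊢
  cases k with
  | zero =>
    have : j = fun _ => 0 := by ext i; simpa using hj i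
    rw [this, dsub_zero]; simpa using hl
  | succ k =>
    by_contra! h
    exact hmin k k.lt_succ_self ⟨j, by simp, h⟩

lemma ofReal_mul_volume_le_of_hasLargeChild (hL : 0 < L) (hf : IntegrableOn f (cube n c L))
    {k : ℕ} {j : Fin n → ℕ} (hj : ∀ i, j i < 2 ^ k)
    (h : HasLargeChild n c L f m (2 * l) k j) {a : ℝ} (ha : |a - m| ≤ l) :
    ENNReal.ofReal l * volume (dsub n c L k j) ≤
      2 ^ n * ∫⁻ x in dsub n c L k j, ENNReal.ofReal |f x - a| := by
  obtain ⟨j', hj', hlt⟩ := h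
  have hsub : dsub n c L (k + 1) j' ⊆ dsub n c L k j := by
    have := dsub_subset_ancestor (c := c) hL (Nat.le_succ k) j'
    simpa [hj'] using this
  have hge : l ≤ |(⨍ y in dsub n c L (k + 1) j', f y) - a| := by
    have := abs_sub_le (⨍ y in dsub n c L (k + 1) j', f y) a m
    linarith
  rw [volume_dsub_eq_mul_child k j j', mul_left_comm]
  gcongr
  exact (ofReal_mul_measure_le_lintegral_of_lt_abs_average_sub (volume_dsub_ne_zero hL _ _)
    (volume_dsub_ne_top _ _) (hf.mono_set (hsub.trans (dsub_subset_cube hL hj))) hge).trans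
    (lintegral_mono_set hsub)

lemma ofReal_mul_volume_stopSet_two_mul_le (hL : 0 < L) (hf : IntegrableOn f (cube n c L))
    (hl : 0 ≤ l) :
    ENNReal.ofReal l * volume (stopSet n c L f (⨍ y in cube n c L, f y) (2 * l)) ≤
      2 ^ n * ∑' R : stopCubes n c L f (⨍ y in cube n c L, f y) l,
        ∫⁻ x in dsub n c L R.1.1 R.1.2,
          ENNReal.ofReal |f x - ⨍ y in dsub n c L R.1.1 R.1.2, f y| := by
  set m := ⨍ y in cube n c L, f y with hm
  let g : ℕ × (Fin n → ℕ) → (Fin n → ℝ) → ℝ≥0∞ :=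
    fun R x => ENNReal.ofReal |f x - ⨍ y in dsub n c L R.1 R.2, f y|
  let D : ℕ × (Fin n → ℕ) → Set (Fin n → ℝ) := fun R => dsub n c L R.1 R.2
  have hD : ∀ R, MeasurableSet (D R) := fun R => measurableSet_dsub _ _
  have hone : ∀ S : stopCubes n c L f m (2 * l), ENNReal.ofReal l * volume (D S) ≤
      ∑' R : stopCubes n c L f m l, 2 ^ n * ∫⁻ x in D S ∩ D R, g R x := by
    rintro ⟨S, hS⟩
    obtain ⟨R, hR, hSR⟩ := (hS.2.1.mono (by linarith : l ≤ 2 * l)).exists_stopCube hL hS.1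
    refine le_trans ?_ (ENNReal.le_tsum ⟨R, hR⟩)
    rw [Set.inter_eq_left.2 hSR]
    exact ofReal_mul_volume_le_of_hasLargeChild hL hf hS.1 hS.2.1
      (abs_average_sub_le_of_mem_stopCubes hl hR)
  rw [volume_stopSet hL, ← ENNReal.tsum_mul_left, ← ENNReal.tsum_mul_left]
  refine (ENNReal.tsum_le_tsum hone).trans ?_
  rw [ENNReal.tsum_comm]
  refine ENNReal.tsum_le_tsum fun R => ?_
  rw [ENNReal.tsum_mul_left]
  gcongr
  rw [← lintegral_iUnion
    (fun S : stopCubes n c L f m (2 * l) => (hD S).inter (hD R)) _ (g R)]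
  · exact lintegral_mono_set (Set.iUnion_subset fun S => Set.inter_subset_right)
  · intro S T hST
    exact ((pairwiseDisjoint_stopCubes hL S.2 T.2 (Subtype.coe_injective.ne hST)).mono
      Set.inter_subset_left Set.inter_subset_left)

lemma volume_stopSet_two_mul_le {p C₀ : ℝ} (hL : 0 < L) (hf : IntegrableOn f (cube n c L))
    (hl : 0 ≤ l) (hG : GaRoConst n c L p f C₀) :
    ENNReal.ofReal l * volume (stopSet n c L f (⨍ y in cube n c L, f y) (2 * l)) ≤
      2 ^ n * (ENNReal.ofReal C₀ *
        volume (stopSet n c L f (⨍ y in cube n c L, f y) l) ^ (1 - 1 / p)) := by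
  refine (ofReal_mul_volume_stopSet_two_mul_le hL hf hl).trans ?_
  gcongr
  have h := hG (stopCubes n c L f (⨍ y in cube n c L, f y) l) (fun Q hQ => hQ.1)
    (pairwiseDisjoint_stopCubes hL)
  have hsum : ∀ (s : Set (ℕ × (Fin n → ℕ))) (a : ℕ × (Fin n → ℕ) → ℝ≥0∞),
      (∑' Q, if Q ∈ s then a Q else 0) = ∑' Q : s, a Q := fun s a => by
    rw [tsum_subtype]
    exact tsum_congr fun Q => by simp [Set.indicator_apply]
  rw [hsum, hsum _ fun Q => volume (dsub n c L Q.1 Q.2), ← volume_stopSet hL] at h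
  refine le_trans (ENNReal.tsum_le_tsum fun R => ?_) h
  exact lintegral_abs_sub_average_le (volume_dsub_ne_zero hL _ _) (volume_dsub_ne_top _ _)
    (hf.mono_set (dsub_subset_cube hL R.2.1))

lemma volume_superlevel_le_volume_stopSet (hL : 0 < L) (hf : IntegrableOn f (cube n c L)) :
    volume {x ∈ cube n c L | l < |f x - m|} ≤ volume (stopSet n c L f m l) := by
  refine measure_mono_ae ?_
  filter_upwards [ae_tendsto_average_dsub hL hf] with x hx hxl
  obtain ⟨hxc, hxl⟩ := hxl
  have h0 : ∀ i, c i ≤ x i := fun i => (hxc i (Set.mem_univ i)).1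
  obtain ⟨k, hk⟩ := Filter.Eventually.exists
    (((Filter.tendsto_add_atTop_iff_nat 1).2 (hx hxc)).sub_const m |>.abs.eventually
      (lt_mem_nhds hxl))
  have hb : HasLargeChild n c L f m l k (dyadicIndex c L k x) :=
    ⟨dyadicIndex c L (k + 1) x, fun i => by
      simpa using dyadicIndex_div (c := c) (L := L) k 1 x i, hk⟩
  obtain ⟨Q, hQ, hsub⟩ := hb.exists_stopCube hL (dyadicIndex_lt hL hxc k)
  exact Set.mem_biUnion hQ (hsub ((mem_dsub_iff hL h0 k _).2 rfl))

end Stopping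

lemma ENNReal.rpow_one_div_le_of_le_mul_rpow {p : ℝ} (hp : 0 < p) {S K : ℝ≥0∞} (hS : S ≠ ∞)
    (h : S ≤ K * S ^ (1 - 1 / p)) : S ^ (1 / p) ≤ K := by
  rcases eq_or_ne S 0 with rfl | h0
  · rw [ENNReal.zero_rpow_of_pos (by positivity)]; exact zero_le
  · have hne : S ^ (1 - 1 / p) ≠ 0 := (ENNReal.rpow_pos (pos_iff_ne_zero.2 h0) hS).ne'
    have hne' : S ^ (1 - 1 / p) ≠ ∞ := ENNReal.rpow_ne_top_of_ne_zero h0 hS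
    rw [← ENNReal.mul_le_mul_iff_left hne hne', ← ENNReal.rpow_add _ _ h0 hS]
    simpa using h

/-- If `φ (2 l) ≤ K φ(l) ^ (1 - 1 / p)` and `φ` is bounded near `0`,
then `φ ^ (1 / p)` is bounded by `K`. -/
lemma rpow_one_div_le_of_doubling {p : ℝ} (hp : 1 < p) {φ : ℝ → ℝ≥0∞} {K : ℝ≥0∞}
    (hfin : ∀ M, ∃ B ≠ ∞, ∀ l, 0 < l → l ≤ M → φ l ≤ B)
    (h : ∀ l, 0 < l → φ (2 * l) ≤ K * φ l ^ (1 - 1 / p)) {l : ℝ} (hl : 0 < l) :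
    φ l ^ (1 / p) ≤ K := by
  have hq : 0 ≤ 1 - 1 / p := by
    rw [sub_nonneg, div_le_one (by positivity)]; exact hp.le
  obtain ⟨B, hB, hφ⟩ := hfin l
  let S := ⨆ t ∈ Set.Ioc 0 l, φ t
  have hS : S ≠ ∞ := ne_top_of_le_ne_top hB (iSup₂_le fun t ht => hφ t ht.1 ht.2)
  have hSK : S ≤ K * S ^ (1 - 1 / p) := by
    refine iSup₂_le fun t ht => ?_
    have ht2 : t / 2 ∈ Set.Ioc 0 l := ⟨half_pos ht.1, (half_le_self ht.1.le).trans ht.2⟩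
    have := h (t / 2) ht2.1
    rw [mul_div_cancel₀ t two_ne_zero] at this
    refine this.trans ?_
    gcongr
    exact le_iSup₂ (f := fun t (_ : t ∈ Set.Ioc 0 l) => φ t) (t / 2) ht2
  refine le_trans ?_ (ENNReal.rpow_one_div_le_of_le_mul_rpow (by positivity) hS hSK)
  gcongr
  exact le_iSup₂ (f := fun t (_ : t ∈ Set.Ioc 0 l) => φ t) l ⟨hl, le_rfl⟩

/-- for `1 < p < ∞` there is `C = C(n,p)` such that for every cube `Q₀ ⊂ ℝⁿ`
and every `f ∈ L¹(Q₀)`, `‖f - f_{Q₀}‖_{L^{p,∞}(Q₀)} ≤ C ‖f‖_{GaRo_p(Q₀,𝒟)}`, where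
`‖f‖_{GaRo_p(Q₀,𝒟)}` is the smallest admissible Garsia–Rodemich constant. -/
theorem statement1 (n : ℕ) (p : ℝ) (hp : 1 < p) :
    ∃ C : ℝ, 0 < C ∧
      ∀ (c : Fin n → ℝ) (L : ℝ), 0 < L →
      ∀ f : (Fin n → ℝ) → ℝ, IntegrableOn f (cube n c L) →
      ∀ C₀ : ℝ, 0 ≤ C₀ → GaRoConst n c L p f C₀ →
      (⨆ l ∈ Set.Ioi (0 : ℝ), ENNReal.ofReal (l ^ p) *
          volume {x ∈ cube n c L | l < |f x - ⨍ y in cube n c L, f y|}) ^ (1 / p)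
        ≤ ENNReal.ofReal (C * C₀) := by
  refine ⟨2 ^ p * 2 ^ n, by positivity, fun c L hL f hf C₀ hC₀ hG => ?_⟩
  have hp0 : 0 < p := by linarith
  let F : ℝ → Set (Fin n → ℝ) := fun l => stopSet n c L f (⨍ y in cube n c L, f y) l
  let φ : ℝ → ℝ≥0∞ := fun l => ENNReal.ofReal (l ^ p) * volume (F l)
  have hvol : volume (cube n c L) ≠ ∞ := by
    rw [← dsub_zero]; exact volume_dsub_ne_top _ _
  have hfin : ∀ M, ∃ B ≠ ∞, ∀ l, 0 < l → l ≤ M → φ l ≤ B := fun M =>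
    ⟨ENNReal.ofReal (M ^ p) * volume (cube n c L),
      ENNReal.mul_ne_top ENNReal.ofReal_ne_top hvol, fun l hl hlM =>
      mul_le_mul' (ENNReal.ofReal_le_ofReal (Real.rpow_le_rpow hl.le hlM hp0.le))
        (measure_mono (stopSet_subset_cube hL))⟩
  have hstep : ∀ l, 0 < l →
      φ (2 * l) ≤ ENNReal.ofReal (2 ^ p * 2 ^ n * C₀) * φ l ^ (1 - 1 / p) := fun l hl => by
    have hq : 0 ≤ 1 - 1 / p := by
      rw [sub_nonneg, div_le_one hp0]; exact hp.le
    have h1 : (2 * l) ^ p = 2 ^ p * (l ^ p) ^ (1 - 1 / p) * l := by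
      rw [Real.mul_rpow zero_le_two hl.le, ← Real.rpow_mul hl.le, mul_assoc,
        ← Real.rpow_add_one hl.ne']
      congr 2
      field_simp; ring
    calc φ (2 * l) = ENNReal.ofReal (2 ^ p) * ENNReal.ofReal ((l ^ p) ^ (1 - 1 / p)) *
          (ENNReal.ofReal l * volume (F (2 * l))) := by
          simp only [φ]
          rw [h1, ENNReal.ofReal_mul (by positivity), ENNReal.ofReal_mul (by positivity), mul_assoc]
      _ ≤ ENNReal.ofReal (2 ^ p) * ENNReal.ofReal ((l ^ p) ^ (1 - 1 / p)) *
          (2 ^ n * (ENNReal.ofReal C₀ * volume (F l) ^ (1 - 1 / p))) := by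
          exact mul_le_mul_right (volume_stopSet_two_mul_le hL hf hl.le hG) _
      _ = _ := by
          simp only [φ]
          rw [ENNReal.mul_rpow_of_nonneg _ _ hq, ENNReal.ofReal_rpow_of_nonneg (by positivity) hq,
            ENNReal.ofReal_mul (by positivity), ENNReal.ofReal_mul (by positivity),
            ENNReal.ofReal_pow zero_le_two, ENNReal.ofReal_ofNat]
          ring
  rw [one_div, ENNReal.rpow_inv_le_iff hp0]
  refine iSup₂_le fun l hl => ?_
  rw [← ENNReal.rpow_inv_le_iff hp0, ← one_div]
  refine le_trans ?_ (rpow_one_div_le_of_doubling hp hfin hstep hl)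
  exact ENNReal.rpow_le_rpow
    (mul_le_mul_right (volume_superlevel_le_volume_stopSet hL hf) _) (by positivity)
end
end

section
/- Let 1 < p < ∞, let γ ∈ ℝ with γ ∉ [0,n], and let f ∈ L¹_loc(ℝⁿ) (with respect to Lebesgue measure). Define b(f)(x,t) = t^{γ/p} O(f,B(x,t)) for (x,t) ∈ ℝⁿ × (0,∞), and let ν_γ be the measure on ℝⁿ × (0,∞) given by dν_γ = dx dt / t^{1+γ}. Then there is a constant C = C(n,p,γ) such that sup_{λ>0} λᵖ ν_γ({(x,t) : b(f)(x,t) > λ}) ≤ C · ‖f‖ᵖ_{JNₚ(ℝⁿ)}. -/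
open MeasureTheory Set
open scoped ENNReal Classical

noncomputable section

/-- The open Euclidean ball of center `x` and radius `t` in `ℝⁿ`. -/
def eBall {n : ℕ} (x : Fin n → ℝ) (t : ℝ) : Set (Fin n → ℝ) :=
  {y | ∑ i, (y i - x i) ^ 2 < t ^ 2}

/-- The mean oscillation `O(f,E) = ⨍_E |f - ⨍_E f|` (w.r.t. Lebesgue measure). -/
def osc {n : ℕ} (f : (Fin n → ℝ) → ℝ) (E : Set (Fin n → ℝ)) : ℝ :=
  ⨍ x in E, |f x - ⨍ y in E, f y|

/-- The measure `ν_γ` on `ℝⁿ × (0,∞)` given by `dν_γ = dx dt / t^{1+γ}`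
(realized on `ℝⁿ × ℝ`; only sets of points with positive last coordinate are used). -/
def nuGamma (n : ℕ) (γ : ℝ) : Measure ((Fin n → ℝ) × ℝ) :=
  (volume.prod volume).withDensity fun z => ENNReal.ofReal (z.2 ^ (-(1 + γ)))

/-- The `p`-th power of the John–Nirenberg norm `‖f‖_{JN_p(ℝⁿ)}`: the supremum over
all pairwise disjoint collections of (arbitrary, axis-parallel) cubes, indexed by their
corners `Q.1` and (positive) sidelengths `Q.2`, of `∑_Q |Q| O(f,Q)^p`. -/
def JNpPow (n : ℕ) (p : ℝ) (f : (Fin n → ℝ) → ℝ) : ℝ≥0∞ :=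
  ⨆ (P : Set ((Fin n → ℝ) × ℝ))
    (_ : (∀ Q ∈ P, 0 < Q.2) ∧ P.PairwiseDisjoint fun Q => cube n Q.1 Q.2),
    ∑' Q : (Fin n → ℝ) × ℝ,
      if Q ∈ P then
        volume (cube n Q.1 Q.2) * ENNReal.ofReal (osc f (cube n Q.1 Q.2) ^ p) else 0

theorem volume_cube {n : ℕ} (c : Fin n → ℝ) (L : ℝ) :
    volume (cube n c L) = ENNReal.ofReal L ^ n := by
  simp [cube, volume_pi_pi]

theorem volume_real_cube {n : ℕ} (c : Fin n → ℝ) {L : ℝ} (hL : 0 ≤ L) :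
    volume.real (cube n c L) = L ^ n := by
  rw [Measure.real, volume_cube, ENNReal.toReal_pow, ENNReal.toReal_ofReal hL]

theorem cube_subset_Icc {n : ℕ} (c : Fin n → ℝ) (L : ℝ) :
    cube n c L ⊆ Icc c (fun i => c i + L) := fun _ hy =>
  ⟨fun i => (hy i trivial).1, fun i => (hy i trivial).2.le⟩

theorem cube_nonempty {n : ℕ} (c : Fin n → ℝ) {L : ℝ} (hL : 0 < L) : (cube n c L).Nonempty :=
  ⟨c, fun i _ => ⟨le_rfl, by linarith⟩⟩

theorem interior_cube_nonempty {n : ℕ} (c : Fin n → ℝ) {L : ℝ} (hL : 0 < L) :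
    (interior (cube n c L)).Nonempty := by
  rw [cube, interior_pi_set finite_univ]
  refine ⟨fun i => c i + L / 2, fun i _ => ?_⟩
  simp only [interior_Ico, mem_Ioo]
  constructor <;> linarith

theorem eBall_subset_cube {n : ℕ} (x : Fin n → ℝ) {t : ℝ} (ht : 0 < t) :
    eBall x t ⊆ cube n (fun i => x i - t) (2 * t) := by
  intro y hy i _
  have h : (y i - x i) ^ 2 < t ^ 2 :=
    (Finset.single_le_sum (f := fun i => (y i - x i) ^ 2) (fun j _ => sq_nonneg _)
      (Finset.mem_univ i)).trans_lt hy
  have h' := abs_lt.1 (abs_lt_of_sq_lt_sq h ht.le)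
  constructor <;> simp only <;> linarith [h'.1, h'.2]

theorem cube_subset_eBall {n : ℕ} (x : Fin n → ℝ) {t : ℝ} (ht : 0 < t) :
    cube n (fun i => x i - t / (n + 1)) (2 * t / (n + 1)) ⊆ eBall x t := by
  intro y hy
  have hn : (0 : ℝ) < n + 1 := by positivity
  have h : ∀ i, (y i - x i) ^ 2 ≤ (t / (n + 1)) ^ 2 := by
    intro i
    have h1 := (hy i trivial).1
    have h2 := (hy i trivial).2
    simp only at h1 h2
    rw [mul_div_assoc] at h2
    exact sq_le_sq' (by linarith) (by linarith)
  calc ∑ i, (y i - x i) ^ 2 ≤ ∑ _i : Fin n, (t / (n + 1)) ^ 2 := Finset.sum_le_sum fun i _ => h i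
    _ = t ^ 2 * (n / (n + 1) ^ 2) := by
      rw [Finset.sum_const, Finset.card_univ, Fintype.card_fin, nsmul_eq_mul]; field_simp
    _ < t ^ 2 * 1 := by
      have : (n : ℝ) / (n + 1) ^ 2 < 1 := by
        rw [div_lt_one (by positivity)]; nlinarith [n.cast_nonneg (α := ℝ)]
      gcongr
    _ = t ^ 2 := mul_one _

theorem osc_nonneg {n : ℕ} (f : (Fin n → ℝ) → ℝ) (E : Set (Fin n → ℝ)) : 0 ≤ osc f E := by
  rw [osc, setAverage_eq, smul_eq_mul]
  exact mul_nonneg (by positivity) (integral_nonneg fun _ => abs_nonneg _)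

theorem osc_le_of_subset {n : ℕ} {f : (Fin n → ℝ) → ℝ} {E F : Set (Fin n → ℝ)}
    (hEF : E ⊆ F) (hf : IntegrableOn f F)
    (hFfin : volume F ≠ ∞) (hE0 : 0 < volume.real E) {K : ℝ}
    (hK : volume.real F ≤ K * volume.real E) :
    osc f E ≤ 2 * K * osc f F := by
  set m := ⨍ y in F, f y
  have hcF : ∀ c : ℝ, IntegrableOn (fun _ => c) F := fun c => integrableOn_const hFfin
  have hsub : ∀ c : ℝ, IntegrableOn (fun x => |f x - c|) F := fun c => (hf.sub (hcF c)).abs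
  have hmean : |(⨍ y in E, f y) - m| * volume.real E ≤ ∫ x in E, |f x - m| := by
    have : (⨍ y in E, f y) - m = (volume.real E)⁻¹ * ∫ x in E, (f x - m) := by
      rw [integral_sub (hf.mono_set hEF) ((hcF m).mono_set hEF), setAverage_eq, smul_eq_mul,
        setIntegral_const, smul_eq_mul]
      field_simp
    rw [this, abs_mul, abs_of_nonneg (by positivity), mul_right_comm, inv_mul_cancel₀ hE0.ne',
      one_mul]
    exact abs_integral_le_integral_abs
  have hE : ∫ x in E, |f x - ⨍ y in E, f y| ≤ 2 * ∫ x in E, |f x - m| := by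
    calc ∫ x in E, |f x - ⨍ y in E, f y|
        ≤ ∫ x in E, (|f x - m| + |(⨍ y in E, f y) - m|) := by
          refine integral_mono ((hsub _).mono_set hEF)
            (((hsub m).mono_set hEF).add ((hcF _).mono_set hEF)) fun x => ?_
          simpa only [abs_sub_comm m] using abs_sub_le (f x) m (⨍ y in E, f y)
      _ = (∫ x in E, |f x - m|) + |(⨍ y in E, f y) - m| * volume.real E := by
          rw [integral_add ((hsub m).mono_set hEF) ((hcF _).mono_set hEF), setIntegral_const,
            smul_eq_mul, mul_comm (volume.real E)]
      _ ≤ 2 * ∫ x in E, |f x - m| := by linarith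
  have hEF' : ∫ x in E, |f x - m| ≤ ∫ x in F, |f x - m| :=
    setIntegral_mono_set (hsub m) (Filter.Eventually.of_forall fun _ => abs_nonneg _)
      hEF.eventuallyLE
  have hF0 : 0 < volume.real F := hE0.trans_le (measureReal_mono hEF hFfin)
  have hKE : (volume.real E)⁻¹ ≤ K * (volume.real F)⁻¹ := by
    rw [inv_le_iff_one_le_mul₀ hE0, mul_assoc, inv_mul_eq_div, mul_div_assoc', le_div_iff₀ hF0]
    linarith
  rw [osc, osc, setAverage_eq, setAverage_eq _ (fun x => |f x - m|), smul_eq_mul, smul_eq_mul]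
  calc (volume.real E)⁻¹ * ∫ x in E, |f x - ⨍ y in E, f y|
      ≤ (K * (volume.real F)⁻¹) * (2 * ∫ x in F, |f x - m|) :=
        mul_le_mul hKE (hE.trans (by linarith)) (integral_nonneg fun _ => abs_nonneg _)
          ((inv_pos.2 hE0).le.trans hKE)
    _ = 2 * K * ((volume.real F)⁻¹ * ∫ x in F, |f x - m|) := by ring

theorem osc_eBall_le_osc_cube {n : ℕ} {f : (Fin n → ℝ) → ℝ} (hf : LocallyIntegrable f)
    (x : Fin n → ℝ) {t : ℝ} (ht : 0 < t) :
    osc f (eBall x t) ≤ 2 * (n + 1) ^ n * osc f (cube n (fun i => x i - t) (2 * t)) := by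
  have hn : (0 : ℝ) < n + 1 := by positivity
  have hfin : volume (cube n (fun i => x i - t) (2 * t)) ≠ ∞ := by
    rw [volume_cube]; exact ENNReal.pow_ne_top ENNReal.ofReal_ne_top
  have hvol : (2 * t / (n + 1)) ^ n ≤ volume.real (eBall x t) := by
    rw [← volume_real_cube (fun i => x i - t / (n + 1)) (by positivity)]
    exact measureReal_mono (cube_subset_eBall x ht)
      (measure_ne_top_of_subset (eBall_subset_cube x ht) hfin)
  refine osc_le_of_subset (eBall_subset_cube x ht)
    ((hf.integrableOn_isCompact isCompact_Icc).mono_set (cube_subset_Icc _ _)) hfin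
    (lt_of_lt_of_le (by positivity) hvol) ?_
  rw [volume_real_cube _ (by positivity)]
  calc (2 * t) ^ n = (n + 1) ^ n * (2 * t / (n + 1)) ^ n := by
        rw [← mul_pow]; congr 1; field_simp
    _ ≤ _ := by gcongr

theorem nuGamma_setOf_dist_le {n : ℕ} (γ : ℝ) (c : Fin n → ℝ) {S : Set ℝ} (hS : MeasurableSet S)
    {g : ℝ → ℝ} (hg : Measurable g) (hg0 : ∀ t ∈ S, 0 ≤ g t) :
    nuGamma n γ {z | z.2 ∈ S ∧ dist z.1 c ≤ g z.2} =
      ∫⁻ t in S, ENNReal.ofReal ((2 * g t) ^ n) * ENNReal.ofReal (t ^ (-(1 + γ))) := by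
  have hA : MeasurableSet {z : (Fin n → ℝ) × ℝ | z.2 ∈ S ∧ dist z.1 c ≤ g z.2} :=
    (measurable_snd hS).inter (measurableSet_le
      (measurable_fst.dist measurable_const) (hg.comp measurable_snd))
  have hm : Measurable fun z : (Fin n → ℝ) × ℝ => ENNReal.ofReal (z.2 ^ (-(1 + γ))) := by
    fun_prop
  rw [nuGamma, withDensity_apply _ hA, ← lintegral_indicator hA,
    lintegral_prod_symm _ (hm.indicator hA).aemeasurable, ← lintegral_indicator hS]
  refine lintegral_congr fun t => ?_
  by_cases ht : t ∈ S
  · have hvol : ENNReal.ofReal ((2 * g t) ^ n) = volume (Metric.closedBall c (g t)) := by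
      rw [Real.volume_pi_closedBall c (hg0 t ht), Fintype.card_fin]
    rw [indicator_of_mem ht, hvol, mul_comm,
      ← lintegral_indicator_const measurableSet_closedBall]
    refine lintegral_congr fun x => ?_
    simp [indicator_apply, ht]
  · simp [ht]

theorem exists_nuGamma_tent_le {n : ℕ} {γ : ℝ} (hγ : γ ∉ Icc (0 : ℝ) n) :
    ∃ C : ℝ, 0 < C ∧ ∀ (c : Fin n → ℝ) (L : ℝ), 0 < L →
      nuGamma n γ {z | 0 < z.2 ∧ (2 * z.2) ^ (n - γ) ≤ 2 ^ |n - γ| * L ^ (n - γ) ∧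
        dist z.1 c ≤ z.2 + L / 2} ≤ ENNReal.ofReal (C * L ^ (n - γ)) := by
  have hn0 : (0 : ℝ) ≤ n := n.cast_nonneg
  rcases lt_or_ge γ 0 with h0 | h0
  · refine ⟨3 ^ n / (-γ), div_pos (by positivity) (by linarith), fun c L hL => ?_⟩
    have hs : 0 < n - γ := by linarith
    calc _ ≤ nuGamma n γ {z | z.2 ∈ Ioc 0 L ∧ dist z.1 c ≤ 3 * L / 2} := by
          refine measure_mono ?_
          rintro z ⟨hz, hzL, hd⟩
          rw [abs_of_pos hs, ← Real.mul_rpow (by norm_num) hL.le,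
            Real.rpow_le_rpow_iff (by positivity) (by positivity) hs] at hzL
          exact ⟨⟨hz, by linarith⟩, by linarith⟩
      _ = ENNReal.ofReal ((3 * L) ^ n) * ENNReal.ofReal (∫ t in Ioc 0 L, t ^ (-(1 + γ))) := by
          rw [nuGamma_setOf_dist_le γ c measurableSet_Ioc measurable_const
            (fun _ _ => by positivity), lintegral_const_mul _ (by fun_prop),
            ofReal_integral_eq_lintegral_ofReal]
          · congr 3; ring
          · rw [← IntegrableOn, ← intervalIntegrable_iff_integrableOn_Ioc_of_le hL.le]
            exact intervalIntegral.intervalIntegrable_rpow' (by linarith)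
          · filter_upwards [ae_restrict_mem measurableSet_Ioc] with t ht
            exact Real.rpow_nonneg ht.1.le _
      _ = ENNReal.ofReal (3 ^ n / (-γ) * L ^ (n - γ)) := by
          rw [← intervalIntegral.integral_of_le hL.le, integral_rpow (Or.inl (by linarith)),
            show -(1 + γ) + 1 = -γ by ring, Real.zero_rpow (by linarith), sub_zero,
            ← ENNReal.ofReal_mul (by positivity), sub_eq_add_neg, Real.rpow_add hL,
            Real.rpow_natCast]
          congr 1
          ring
  · have hs : n - γ < 0 := by
      by_contra h
      exact hγ ⟨h0, by linarith⟩
    refine ⟨6 ^ n * (1 / 4) ^ (n - γ) / (-(n - γ)), div_pos (by positivity) (by linarith),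
      fun c L hL => ?_⟩
    calc _ ≤ nuGamma n γ {z | z.2 ∈ Ici (L / 4) ∧ dist z.1 c ≤ 3 * z.2} := by
          refine measure_mono ?_
          rintro z ⟨hz, hzL, hd⟩
          rw [abs_of_neg hs, Real.rpow_neg (by norm_num), ← Real.inv_rpow (by norm_num),
            ← Real.mul_rpow (by norm_num) hL.le,
            Real.rpow_le_rpow_iff_of_neg (by positivity) (by positivity) hs] at hzL
          exact ⟨by simp only [mem_Ici]; linarith, by linarith⟩
      _ = ∫⁻ t in Ioi (L / 4), ENNReal.ofReal (6 ^ n * t ^ (n - γ - 1)) := by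
          rw [nuGamma_setOf_dist_le γ c measurableSet_Ici (by fun_prop)
            (fun t (ht : L / 4 ≤ t) => by linarith), setLIntegral_congr Ioi_ae_eq_Ici.symm]
          refine setLIntegral_congr_fun measurableSet_Ioi fun t (ht : L / 4 < t) => ?_
          have ht0 : 0 < t := by linarith
          rw [← ENNReal.ofReal_mul (by positivity), sub_sub, sub_eq_add_neg, Real.rpow_add ht0,
            Real.rpow_natCast, add_comm γ 1]
          congr 1
          ring
      _ = ENNReal.ofReal (∫ t in Ioi (L / 4), 6 ^ n * t ^ (n - γ - 1)) := by
          rw [ofReal_integral_eq_lintegral_ofReal]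
          · exact (integrableOn_Ioi_rpow_of_lt (by linarith) (by positivity)).const_mul _
          · filter_upwards [ae_restrict_mem measurableSet_Ioi] with t ht
            have ht0 : 0 < t := lt_trans (by positivity) ht
            positivity
      _ ≤ _ := by
          refine ENNReal.ofReal_le_ofReal (le_of_eq ?_)
          rw [integral_const_mul, integral_Ioi_rpow_of_lt (by linarith) (by positivity),
            sub_add_cancel, div_eq_mul_one_div L 4, Real.mul_rpow hL.le (by norm_num)]
          field_simp

theorem tsum_le_JNpPow {n : ℕ} (p : ℝ) (f : (Fin n → ℝ) → ℝ) {P : Set ((Fin n → ℝ) × ℝ)}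
    (hP : ∀ Q ∈ P, 0 < Q.2) (hd : P.PairwiseDisjoint fun Q => cube n Q.1 Q.2) :
    ∑' Q : P, volume (cube n Q.1.1 Q.1.2) * ENNReal.ofReal (osc f (cube n Q.1.1 Q.1.2) ^ p) ≤
      JNpPow n p f := by
  rw [tsum_subtype P fun Q : (Fin n → ℝ) × ℝ =>
    volume (cube n Q.1 Q.2) * ENNReal.ofReal (osc f (cube n Q.1 Q.2) ^ p)]
  simp only [indicator_apply]
  exact le_iSup₂_of_le P ⟨hP, hd⟩ le_rfl

theorem volume_cube_mul_osc_le_JNpPow {n : ℕ} (p : ℝ) (f : (Fin n → ℝ) → ℝ) (c : Fin n → ℝ)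
    {L : ℝ} (hL : 0 < L) :
    volume (cube n c L) * ENNReal.ofReal (osc f (cube n c L) ^ p) ≤ JNpPow n p f := by
  have h := tsum_le_JNpPow p f (P := {(c, L)}) (by simpa using hL) (pairwiseDisjoint_singleton _ _)
  rwa [tsum_singleton (c, L) fun Q : (Fin n → ℝ) × ℝ =>
    volume (cube n Q.1 Q.2) * ENNReal.ofReal (osc f (cube n Q.1 Q.2) ^ p)] at h

theorem rpow_mul_rpow_le_volume_mul_osc {n : ℕ} {p γ : ℝ} (hp : 0 < p)
    {f : (Fin n → ℝ) → ℝ} (hf : LocallyIntegrable f) {l : ℝ} (hl : 0 < l)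
    (x : Fin n → ℝ) {t : ℝ} (ht : 0 < t) (h : l < t ^ (γ / p) * osc f (eBall x t)) :
    ENNReal.ofReal (l ^ p) * ENNReal.ofReal ((2 * t) ^ (n - γ)) ≤
      ENNReal.ofReal (2 ^ (-γ) * (2 * (n + 1) ^ n) ^ p) *
        (volume (cube n (fun i => x i - t) (2 * t)) *
          ENNReal.ofReal (osc f (cube n (fun i => x i - t) (2 * t)) ^ p)) := by
  set o := osc f (cube n (fun i => x i - t) (2 * t))
  have ho : 0 ≤ o := osc_nonneg _ _
  have h1 : l ≤ t ^ (γ / p) * (2 * (n + 1) ^ n * o) :=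
    h.le.trans (by gcongr; exact osc_eBall_le_osc_cube hf x ht)
  have h2 : l ^ p ≤ t ^ γ * ((2 * (n + 1) ^ n) ^ p * o ^ p) := by
    calc l ^ p ≤ (t ^ (γ / p) * (2 * (n + 1) ^ n * o)) ^ p := by gcongr
      _ = _ := by
        rw [Real.mul_rpow (by positivity) (by positivity), ← Real.rpow_mul ht.le,
          div_mul_cancel₀ _ hp.ne', Real.mul_rpow (by positivity) ho]
  rw [volume_cube, ← ENNReal.ofReal_pow (by positivity), ← ENNReal.ofReal_mul (by positivity),
    ← ENNReal.ofReal_mul (by positivity), ← ENNReal.ofReal_mul (by positivity)]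
  refine ENNReal.ofReal_le_ofReal ?_
  calc l ^ p * (2 * t) ^ (n - γ)
      ≤ t ^ γ * ((2 * (n + 1) ^ n) ^ p * o ^ p) * (2 * t) ^ (n - γ) := by gcongr
    _ = 2 ^ (-γ) * (2 * (n + 1) ^ n) ^ p * ((2 * t) ^ n * o ^ p) := by
      rw [sub_eq_add_neg, Real.rpow_add (by positivity), Real.rpow_natCast,
        Real.mul_rpow (z := -γ) (by norm_num) ht.le, Real.rpow_neg ht.le]
      field_simp

/-- for `1 < p < ∞`, `γ ∉ [0,n]` and `f ∈ L¹_loc(ℝⁿ)`, with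
`b(f)(x,t) = t^{γ/p} O(f,B(x,t))`, one has
`sup_{λ>0} λ^p ν_γ({b(f) > λ}) ≤ C ‖f‖_{JN_p(ℝⁿ)}^p`. -/
theorem statement17 (n : ℕ) (p γ : ℝ) (hp : 1 < p) (hγ : γ ∉ Set.Icc (0 : ℝ) n) :
    ∃ C : ℝ, 0 < C ∧
      ∀ f : (Fin n → ℝ) → ℝ, LocallyIntegrable f volume →
      (⨆ l ∈ Set.Ioi (0 : ℝ), ENNReal.ofReal (l ^ p) *
          nuGamma n γ {z : (Fin n → ℝ) × ℝ |
            0 < z.2 ∧ l < z.2 ^ (γ / p) * osc f (eBall z.1 z.2)})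
        ≤ ENNReal.ofReal C * JNpPow n p f := by
  obtain ⟨C₁, hC₁, htent⟩ := exists_nuGamma_tent_le hγ
  set s : ℝ := n - γ
  set K : ℝ := 2 ^ (-γ) * (2 * (n + 1) ^ n) ^ p
  have hK0 : 0 < K := by positivity
  refine ⟨C₁ * K, by positivity, fun f hf => iSup₂_le fun l hl => ?_⟩
  have hl : 0 < l := hl
  rcases eq_or_ne (JNpPow n p f) ∞ with hM | hM
  · rw [hM, ENNReal.mul_top (by simpa using by positivity)]
    exact le_top
  have hs0 : s ≠ 0 := fun h => hγ ⟨by linarith [n.cast_nonneg (α := ℝ)], by linarith⟩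
  let T : Set ((Fin n → ℝ) × ℝ) := {Q | 0 < Q.2 ∧ ENNReal.ofReal (l ^ p) *
    ENNReal.ofReal (Q.2 ^ s) ≤ ENNReal.ofReal K * (volume (cube n Q.1 Q.2) *
      ENNReal.ofReal (osc f (cube n Q.1 Q.2) ^ p))}
  have hR : ∀ Q ∈ T, Q.2 ^ s ≤ (ENNReal.ofReal K * JNpPow n p f).toReal / l ^ p := by
    rintro Q ⟨hQ, hQT⟩
    have h := hQT.trans (mul_le_mul_right (volume_cube_mul_osc_le_JNpPow p f Q.1 hQ) _)
    rw [← ENNReal.ofReal_mul (by positivity),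
      ENNReal.ofReal_le_iff_le_toReal (ENNReal.mul_ne_top ENNReal.ofReal_ne_top hM)] at h
    rw [le_div_iff₀ (by positivity)]
    linarith
  obtain ⟨u, huT, hud, hcov⟩ := Vitali.exists_disjoint_subfamily_covering_enlargement
    (fun Q : (Fin n → ℝ) × ℝ => cube n Q.1 Q.2) T (fun Q => Q.2 ^ s) (2 ^ |s|)
    (Real.one_lt_rpow (by norm_num) (abs_pos.2 hs0)) (fun Q hQ => Real.rpow_nonneg hQ.1.le _) _ hR
    (fun Q hQ => cube_nonempty _ hQ.1)
  have hu0 : ∀ Q ∈ u, 0 < Q.2 := fun Q hQ => (huT hQ).1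
  have hucount : u.Countable := hud.countable_of_nonempty_interior
    fun Q hQ => interior_cube_nonempty _ (hu0 Q hQ)
  have := hucount.to_subtype
  have hsub : {z : (Fin n → ℝ) × ℝ | 0 < z.2 ∧ l < z.2 ^ (γ / p) * osc f (eBall z.1 z.2)} ⊆
      ⋃ Q : u, {z | 0 < z.2 ∧ (2 * z.2) ^ s ≤ 2 ^ |s| * Q.1.2 ^ s ∧
        dist z.1 (fun i => Q.1.1 i + Q.1.2 / 2) ≤ z.2 + Q.1.2 / 2} := by
    rintro ⟨x, t⟩ ⟨ht, hz⟩
    simp only at ht hz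
    obtain ⟨Q, hQ, ⟨y, hy₁, hy₂⟩, hQt⟩ := hcov (fun i => x i - t, 2 * t)
      ⟨by positivity, rpow_mul_rpow_le_volume_mul_osc (by linarith) hf hl x ht hz⟩
    refine mem_iUnion.2 ⟨⟨Q, hQ⟩, ht, hQt, ?_⟩
    have hQ0 := hu0 Q hQ
    refine (dist_pi_le_iff (by positivity)).2 fun i => ?_
    have h₁ := hy₁ i trivial
    have h₂ := hy₂ i trivial
    simp only [mem_Ico] at h₁ h₂
    rw [Real.dist_eq, abs_le]
    constructor <;> linarith [h₁.1, h₁.2, h₂.1, h₂.2]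
  calc _ ≤ ENNReal.ofReal (l ^ p) * ∑' Q : u, ENNReal.ofReal (C₁ * Q.1.2 ^ s) := by
        gcongr
        exact (measure_mono hsub).trans <| (measure_iUnion_le _).trans <|
          ENNReal.tsum_le_tsum fun Q => htent _ _ (hu0 Q.1 Q.2)
    _ = ENNReal.ofReal C₁ *
          ∑' Q : u, ENNReal.ofReal (l ^ p) * ENNReal.ofReal (Q.1.2 ^ s) := by
        simp_rw [ENNReal.ofReal_mul hC₁.le, ENNReal.tsum_mul_left]
        ring
    _ ≤ ENNReal.ofReal C₁ * ∑' Q : u, ENNReal.ofReal K * (volume (cube n Q.1.1 Q.1.2) *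
          ENNReal.ofReal (osc f (cube n Q.1.1 Q.1.2) ^ p)) := by
        exact mul_le_mul_right (ENNReal.tsum_le_tsum fun Q => (huT Q.2).2) _
    _ ≤ ENNReal.ofReal (C₁ * K) * JNpPow n p f := by
        rw [ENNReal.tsum_mul_left, ← mul_assoc, ← ENNReal.ofReal_mul hC₁.le]
        gcongr
        exact tsum_le_JNpPow p f hu0 hud
end
end
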